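/- Let X be a finite set with |X| = S ≥ 2, let p and q be probability distributions on X with q ≪ p, let f : X → ℝ, and let B, C, N be real numbers with B ≥ 1, 0 ≤ C ≤ B, and N ≥ 1. Assume that (i) q(x) − p(x) ≤ √(2·p(x)·C/N) + 2C/N for every x ∈ X, and (ii) KL(q,p) ≤ 4·S·B/N. Then √(V_q(f)) ≤ √(2·V_p(f)) + 6·S·span(f)·B/√N. -/

import Mathlib

open Finset

section Defs
variable {X : Type*} [Fintype X]

/-- `P` is a probability distribution on the finite set `X`. -/
def IsDist (P : X → ℝ) : Prop := (∀ x, 0 ≤ P x) ∧ ∑ x, P x = 1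

/-- `Q ≪ P`: absolute continuity. -/
def AbsCont (Q P : X → ℝ) : Prop := ∀ x, P x = 0 → Q x = 0

/-- Mean of `f` under `P`. -/
noncomputable def distMean (P f : X → ℝ) : ℝ := ∑ x, P x * f x

/-- Variance of `f` under `P`. -/
noncomputable def distVar (P f : X → ℝ) : ℝ := ∑ x, P x * (f x - distMean P f) ^ 2

/-- Kullback-Leibler divergence `KL(Q,P)`. -/
noncomputable def distKL (Q P : X → ℝ) : ℝ :=
  ∑ x, if 0 < Q x then Q x * Real.log (Q x / P x) else 0

/-- The local variance `V_{P,Q}(f) = ∑_{x : P(x) ≥ Q(x)} P(x) (f(x) - E_P f)^2`. -/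
noncomputable def Vloc (P Q f : X → ℝ) : ℝ :=
  ∑ x, if Q x ≤ P x then P x * (f x - distMean P f) ^ 2 else 0

/-- Span of `f`: `max f - min f`. -/
noncomputable def distSpan [Nonempty X] (f : X → ℝ) : ℝ :=
  univ.sup' univ_nonempty f - univ.inf' univ_nonempty f

end Defs

/-- The mean of `f` under a distribution minimizes the mean squared deviation. -/
lemma distVar_le_sum_sq_sub {X : Type*} [Fintype X] {q : X → ℝ} (hq : IsDist q)
    (f : X → ℝ) (m : ℝ) : distVar q f ≤ ∑ x, q x * (f x - m) ^ 2 := by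
  have h : ∑ x, q x * (f x - m) ^ 2 - distVar q f = (distMean q f - m) ^ 2 := by
    have key : ∀ x, q x * (f x - m) ^ 2 - q x * (f x - distMean q f) ^ 2
        = 2 * (distMean q f - m) * (q x * f x) + (m ^ 2 - distMean q f ^ 2) * q x :=
      fun x => by ring
    rw [distVar, ← sum_sub_distrib, sum_congr rfl fun x _ => key x, sum_add_distrib,
      ← mul_sum, ← mul_sum, hq.2, ← distMean]
    ring
  linarith [sq_nonneg (distMean q f - m)]

lemma distSpan_nonneg {X : Type*} [Fintype X] [Nonempty X] (f : X → ℝ) : 0 ≤ distSpan f := by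
  obtain ⟨x⟩ := ‹Nonempty X›
  have h₁ := le_sup' f (mem_univ x)
  have h₂ := inf'_le f (mem_univ x)
  unfold distSpan
  linarith

lemma abs_sub_distMean_le_distSpan {X : Type*} [Fintype X] [Nonempty X] {p : X → ℝ}
    (hp : IsDist p) (f : X → ℝ) (x : X) : |f x - distMean p f| ≤ distSpan f := by
  have hupper : distMean p f ≤ univ.sup' univ_nonempty f := by
    calc distMean p f ≤ ∑ y, p y * univ.sup' univ_nonempty f :=
          sum_le_sum fun y hy => mul_le_mul_of_nonneg_left (le_sup' f hy) (hp.1 y)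
      _ = univ.sup' univ_nonempty f := by rw [← sum_mul, hp.2, one_mul]
  have hlower : univ.inf' univ_nonempty f ≤ distMean p f := by
    calc univ.inf' univ_nonempty f = ∑ y, p y * univ.inf' univ_nonempty f := by
          rw [← sum_mul, hp.2, one_mul]
      _ ≤ distMean p f :=
          sum_le_sum fun y hy => mul_le_mul_of_nonneg_left (inf'_le f hy) (hp.1 y)
  have h₁ := le_sup' f (mem_univ x)
  have h₂ := inf'_le f (mem_univ x)
  unfold distSpan
  rw [abs_le]
  constructor <;> linarith

lemma distVar_nonneg {X : Type*} [Fintype X] {p : X → ℝ} (hp : IsDist p) (f : X → ℝ) :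
    0 ≤ distVar p f :=
  sum_nonneg fun x _ => mul_nonneg (hp.1 x) (sq_nonneg _)

/-- A pointwise bound `q ≤ 2 p + c` controls the variance under `q` by that under `p`. -/
lemma distVar_le_of_le_two_mul_add {X : Type*} [Fintype X] [Nonempty X] {p q : X → ℝ}
    (hp : IsDist p) (hq : IsDist q) (f : X → ℝ) {c : ℝ} (hc : 0 ≤ c)
    (h : ∀ x, q x ≤ 2 * p x + c) :
    distVar q f ≤ 2 * distVar p f + Fintype.card X * (c * distSpan f ^ 2) := by
  calc distVar q f ≤ ∑ x, q x * (f x - distMean p f) ^ 2 := distVar_le_sum_sq_sub hq f _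
    _ ≤ ∑ x, (2 * (p x * (f x - distMean p f) ^ 2) + c * distSpan f ^ 2) := by
        refine sum_le_sum fun x _ => ?_
        have hsq : (f x - distMean p f) ^ 2 ≤ distSpan f ^ 2 :=
          sq_le_sq' (abs_le.1 (abs_sub_distMean_le_distSpan hp f x)).1
            (abs_le.1 (abs_sub_distMean_le_distSpan hp f x)).2
        have h₁ := mul_le_mul_of_nonneg_right (h x) (sq_nonneg (f x - distMean p f))
        have h₂ := mul_le_mul_of_nonneg_left hsq hc
        linarith
    _ = 2 * distVar p f + Fintype.card X * (c * distSpan f ^ 2) := by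
        rw [sum_add_distrib, ← mul_sum, ← distVar, sum_const, card_univ, nsmul_eq_mul]

/-- Variance under an empirical-style distribution `q` close to `p`
(Lemma on `V_{p̂_k}`): under a Bernstein-type closeness assumption and a KL bound,
`√(V_q(f)) ≤ √(2 V_p(f)) + 6 S span(f) B / √N`. -/
theorem sqrt_var_emp_le {X : Type*} [Fintype X] [Nonempty X]
    (hcard : 2 ≤ Fintype.card X)
    (p q : X → ℝ) (hp : IsDist p) (hq : IsDist q) (hqp : AbsCont q p) (f : X → ℝ)
    (B C N : ℝ) (hB : 1 ≤ B) (hC0 : 0 ≤ C) (hCB : C ≤ B) (hN : 1 ≤ N)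
    (hclose : ∀ x, q x - p x ≤ Real.sqrt (2 * p x * C / N) + 2 * C / N)
    (hKL : distKL q p ≤ 4 * (Fintype.card X : ℝ) * B / N) :
    Real.sqrt (distVar q f) ≤
      Real.sqrt (2 * distVar p f)
        + 6 * (Fintype.card X : ℝ) * distSpan f * B / Real.sqrt N := by
  have hN0 : 0 < N := by linarith
  have hCN : 0 ≤ C / N := by positivity
  have hbound : ∀ x, q x ≤ 2 * p x + 5 / 2 * (C / N) := by
    intro x
    have hpx := hp.1 x
    have hamgm : Real.sqrt (2 * p x * C / N) ≤ p x + C / N / 2 := by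
      refine Real.sqrt_le_iff.2 ⟨by positivity, ?_⟩
      rw [mul_div_assoc]
      nlinarith [sq_nonneg (p x - C / N / 2)]
    have hx := hclose x
    rw [mul_div_assoc 2 C N] at hx
    linarith
  have hvar := distVar_le_of_le_two_mul_add hp hq f (by positivity) hbound
  have hL := distSpan_nonneg f
  have hV := distVar_nonneg hp f
  have hS : (2 : ℝ) ≤ Fintype.card X := by exact_mod_cast hcard
  have hb : 0 ≤ 6 * (Fintype.card X : ℝ) * distSpan f * B / Real.sqrt N := by positivity
  have hcoeff : 5 / 2 * (Fintype.card X : ℝ) * C ≤ 36 * (Fintype.card X : ℝ) ^ 2 * B ^ 2 := by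
    have hSB : (Fintype.card X : ℝ) * C ≤ Fintype.card X * B := by gcongr
    have hone : 1 ≤ (Fintype.card X : ℝ) * B := by nlinarith
    nlinarith
  have hrem : (Fintype.card X : ℝ) * (5 / 2 * (C / N) * distSpan f ^ 2)
      ≤ (6 * (Fintype.card X : ℝ) * distSpan f * B / Real.sqrt N) ^ 2 := by
    rw [div_pow, Real.sq_sqrt hN0.le]
    calc (Fintype.card X : ℝ) * (5 / 2 * (C / N) * distSpan f ^ 2)
        = 5 / 2 * (Fintype.card X : ℝ) * C * (distSpan f ^ 2 / N) := by ring
      _ ≤ 36 * (Fintype.card X : ℝ) ^ 2 * B ^ 2 * (distSpan f ^ 2 / N) := by gcongr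
      _ = (6 * (Fintype.card X : ℝ) * distSpan f * B) ^ 2 / N := by ring
  refine Real.sqrt_le_iff.2 ⟨by positivity, ?_⟩
  have hsq : Real.sqrt (2 * distVar p f) ^ 2 = 2 * distVar p f := Real.sq_sqrt (by positivity)
  have hcross := mul_nonneg (Real.sqrt_nonneg (2 * distVar p f)) hb
  rw [add_sq, hsq]
  linarith
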